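/- Let n ≥ 2 and k ≥ 2 be integers, let 0 < T < ∞, and let l > n and 2 < q < ∞ satisfy n/l + 2/q = 1. Let u₁, u₂ : ℝⁿ × [0,T] → ℝ^k be continuous maps with |u_i| ≡ 1 which are smooth on ℝⁿ × (0,T] and solve the harmonic map heat flow ∂_t u_i = Δu_i + |∇u_i|² u_i there, which satisfy ∫₀^T ∫_{ℝⁿ} (|∇u_i|² + |∂_t u_i|²) < ∞ and ‖∇u_i‖_{L^q_t L^l_x(ℝⁿ×[0,T])} < ∞ for i = 1,2, and which have the same initial value u₁(·,0) = u₂(·,0). Then u₁ ≡ u₂ on ℝⁿ × [0,T]. -/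

import Mathlib

open MeasureTheory Metric Set Filter Real ENNReal

noncomputable section

abbrev Sp (n : ℕ) := EuclideanSpace ℝ (Fin n)

/-- The `α`-th spatial coordinate direction in spacetime `ℝⁿ × ℝ`. -/
def sdir (n : ℕ) (α : Fin n) : Sp n × ℝ := (EuclideanSpace.single α 1, 0)

/-- The time direction in spacetime `ℝⁿ × ℝ`. -/
def tdir (n : ℕ) : Sp n × ℝ := (0, 1)

/-- Directional derivative of the `i`-th component of `u` in direction `v`. -/
def pd {n k : ℕ} (u : Sp n × ℝ → Fin k → ℝ) (i : Fin k) (v : Sp n × ℝ) (z : Sp n × ℝ) : ℝ :=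
  fderiv ℝ (fun w => u w i) z v

/-- Squared spatial gradient `|∇u|²`. -/
def gradSq {n k : ℕ} (u : Sp n × ℝ → Fin k → ℝ) (z : Sp n × ℝ) : ℝ :=
  ∑ α : Fin n, ∑ i : Fin k, (pd u i (sdir n α) z) ^ 2

/-- Squared time derivative `|∂ₜu|²`. -/
def dtSq {n k : ℕ} (u : Sp n × ℝ → Fin k → ℝ) (z : Sp n × ℝ) : ℝ :=
  ∑ i : Fin k, (pd u i (tdir n) z) ^ 2

/-- Spatial Laplacian `Δuⁱ`. -/
def lap {n k : ℕ} (u : Sp n × ℝ → Fin k → ℝ) (i : Fin k) (z : Sp n × ℝ) : ℝ :=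
  ∑ α : Fin n, fderiv ℝ (pd u i (sdir n α)) z (sdir n α)

/-- `u` takes values in the unit sphere `S^{k-1}` on `D`. -/
def SphereValued {n k : ℕ} (u : Sp n × ℝ → Fin k → ℝ) (D : Set (Sp n × ℝ)) : Prop :=
  ∀ z ∈ D, ∑ i : Fin k, (u z i) ^ 2 = 1

/-- `u` solves the harmonic map heat flow `∂ₜu = Δu + |∇u|² u` into the sphere on `D`. -/
def HeatFlow {n k : ℕ} (u : Sp n × ℝ → Fin k → ℝ) (D : Set (Sp n × ℝ)) : Prop :=
  ∀ z ∈ D, ∀ i : Fin k, pd u i (tdir n) z = lap u i z + gradSq u z * u z i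

/-- Parabolic cylinder `P_r(z₀) = closedBall(x₀,r) × (t₀ - r², t₀]`. -/
def pcyl {n : ℕ} (z₀ : Sp n × ℝ) (r : ℝ) : Set (Sp n × ℝ) :=
  closedBall z₀.1 r ×ˢ Ioc (z₀.2 - r ^ 2) z₀.2

/-- The mixed norm `‖∇u‖_{L^q_t L^l_x(ℝⁿ × (a,b])}` (as a value in `[0,∞]`). -/
def gradMixedNorm {n k : ℕ} (u : Sp n × ℝ → Fin k → ℝ) (a b l q : ℝ) : ℝ≥0∞ :=
  (∫⁻ t in Ioc a b,
      (∫⁻ x : Sp n, ENNReal.ofReal ((gradSq u (x, t)) ^ (l / 2))) ^ (q / l)) ^ (1 / q)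

open scoped NNReal Topology

section GagliardoNirenberg

variable {E : Type*} [NormedAddCommGroup E] [InnerProductSpace ℝ E] [FiniteDimensional ℝ E]
  [MeasurableSpace E] [BorelSpace E]

/-- In dimension two, the `L^{2m}` norms of a test function are controlled by the `L²` norms of
the function and of its derivative. -/
lemma exists_lintegral_pow_le_of_finrank_eq_two (hE : Module.finrank ℝ E = 2) (m : ℕ) :
    ∃ C : ℝ≥0, ∀ g : E → ℝ, ContDiff ℝ 1 g → HasCompactSupport g →
      ∫⁻ x, (‖g x‖ₑ ^ 2) ^ (m + 1) ≤
        C * (∫⁻ x, ‖g x‖ₑ ^ 2) * (∫⁻ x, ‖fderiv ℝ g x‖ₑ ^ 2) ^ m := by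
  induction m with
  | zero => exact ⟨1, fun g _ _ => by simp⟩
  | succ m ih =>
    obtain ⟨C, hC⟩ := ih
    let K : ℝ≥0 := eLpNormLESNormFDerivOneConst (volume : Measure E) 2
    refine ⟨(K * (m + 2)) ^ 2 * C, fun g hg hgs => ?_⟩
    have hfd : ∀ x, ‖fderiv ℝ (fun y => g y ^ (m + 2)) x‖ₑ =
        (m + 2 : ℝ≥0∞) * (‖g x‖ₑ ^ (m + 1) * ‖fderiv ℝ g x‖ₑ) := by
      intro x
      rw [((hg.differentiable one_ne_zero x).hasFDerivAt.pow (m + 2)).fderiv]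
      rw [enorm_smul, nsmul_eq_mul, enorm_mul, enorm_pow, ← mul_assoc]
      congr 2
      rw [Real.enorm_of_nonneg (by positivity)]
      rw [ENNReal.ofReal_natCast]
      push_cast
      rfl
    have hcont : Continuous (fderiv ℝ g) := hg.continuous_fderiv one_ne_zero
    have hsob := eLpNorm_le_eLpNorm_fderiv_one (volume : Measure E) (u := fun y => g y ^ (m + 2))
      (hg.pow _) (hgs.comp_left (g := fun t : ℝ => t ^ (m + 2)) (by simp)) (p := 2) (by
        rw [hE, NNReal.holderConjugate_iff]
        exact ⟨by norm_num, by rw [← NNReal.coe_inj]; norm_num⟩)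
    have hhol := ENNReal.lintegral_mul_le_Lp_mul_Lq (volume : Measure E)
      (p := 2) (q := 2) (by norm_num [Real.holderConjugate_iff])
      (f := fun x => ‖g x‖ₑ ^ (m + 1)) (g := fun x => ‖fderiv ℝ g x‖ₑ)
      (hg.continuous.enorm.measurable.pow_const _).aemeasurable hcont.enorm.aemeasurable
    rw [eLpNorm_one_eq_lintegral_enorm] at hsob
    simp_rw [hfd] at hsob
    have hmeas : Measurable fun x => ‖g x‖ₑ ^ (m + 1) * ‖fderiv ℝ g x‖ₑ :=
      (hg.continuous.enorm.measurable.pow_const _).mul hcont.enorm.measurable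
    rw [lintegral_const_mul _ hmeas] at hsob
    have h2 := pow_le_pow_left₀ zero_le
      (hsob.trans (mul_le_mul_right (mul_le_mul_right hhol _) _)) 2
    rw [← ENNReal.rpow_natCast, Nat.cast_ofNat] at h2
    have h3 := eLpNorm_nnreal_pow_eq_lintegral (μ := (volume : Measure E))
      (f := fun y => g y ^ (m + 2)) (p := 2) (by norm_num)
    simp only [NNReal.coe_ofNat] at h3
    rw [h3] at h2
    calc ∫⁻ x, (‖g x‖ₑ ^ 2) ^ (m + 1 + 1)
        = ∫⁻ x, ‖g x ^ (m + 2)‖ₑ ^ (2 : ℝ) := by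
          refine lintegral_congr fun x => ?_
          rw [enorm_pow, ENNReal.rpow_ofNat]; ring
      _ ≤ _ := h2
      _ = (K * (m + 2)) ^ 2 * (∫⁻ x, (‖g x‖ₑ ^ 2) ^ (m + 1)) *
            (∫⁻ x, ‖fderiv ℝ g x‖ₑ ^ 2) := by
          have hs : ∀ a : ℝ≥0∞, (a ^ (1 / 2 : ℝ)) ^ 2 = a := by
            intro a
            rw [← ENNReal.rpow_natCast, ← ENNReal.rpow_mul]; norm_num
          simp only [mul_pow, hs, ENNReal.rpow_ofNat]
          have : ∀ x, (‖g x‖ₑ ^ (m + 1)) ^ 2 = (‖g x‖ₑ ^ 2) ^ (m + 1) := fun x => by ring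
          simp_rw [this]
          simp only [K, NNReal.coe_ofNat]
          ring
      _ ≤ (K * (m + 2)) ^ 2 * (C * (∫⁻ x, ‖g x‖ₑ ^ 2) * (∫⁻ x, ‖fderiv ℝ g x‖ₑ ^ 2) ^ m) *
            (∫⁻ x, ‖fderiv ℝ g x‖ₑ ^ 2) := by gcongr; exact hC g hg hgs
      _ = _ := by push_cast; ring

/-- A Gagliardo–Nirenberg inequality for test functions, with an exponent that is large enough
for interpolation against a weight in `L^{l/2}`. -/
lemma exists_lintegral_rpow_le (hE : 2 ≤ Module.finrank ℝ E) {l : ℝ}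
    (hl : (Module.finrank ℝ E : ℝ) < l) :
    ∃ (R : ℝ) (C : ℝ≥0), 1 < R ∧ Module.finrank ℝ E * (R - 1) / 2 ≤ R ∧
      2 * R / (l * (R - 1)) ≤ 1 ∧
      ∀ g : E → ℝ, ContDiff ℝ 1 g → HasCompactSupport g →
      ∫⁻ x, (‖g x‖ₑ ^ 2) ^ R ≤
        C * (∫⁻ x, ‖g x‖ₑ ^ 2) ^ (R - Module.finrank ℝ E * (R - 1) / 2) *
          (∫⁻ x, ‖fderiv ℝ g x‖ₑ ^ 2) ^ (Module.finrank ℝ E * (R - 1) / 2 : ℝ) := by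
  rcases hE.eq_or_lt with h2 | h3
  · rw [← h2] at hl ⊢
    push_cast at hl ⊢
    obtain ⟨m, hm⟩ := exists_nat_ge (2 / (l - 2))
    have hm0 : (0 : ℝ) < m := lt_of_lt_of_le (by apply div_pos <;> linarith) hm
    obtain ⟨C, hC⟩ := exists_lintegral_pow_le_of_finrank_eq_two h2.symm m
    refine ⟨m + 1, C, by linarith, by linarith, ?_, fun g hg hgs => ?_⟩
    · rw [div_le_iff₀ (by linarith)] at hm
      rw [div_le_one (by nlinarith)]
      nlinarith
    · have e1 : ((m : ℝ) + 1 - 2 * (m + 1 - 1) / 2) = 1 := by ring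
      have e2 : (2 * ((m : ℝ) + 1 - 1) / 2) = m := by ring
      rw [e1, e2, ENNReal.rpow_one, ENNReal.rpow_natCast]
      have := hC g hg hgs
      simp_rw [← Nat.cast_succ, ENNReal.rpow_natCast]
      exact this
  · set n : ℝ := ((Module.finrank ℝ E : ℕ) : ℝ) with hn
    have hn3 : (3 : ℝ) ≤ n := by rw [hn]; exact_mod_cast h3
    have e1 : n / (n - 2) - 1 = 2 / (n - 2) := by
      rw [div_sub_one (by linarith)]; ring
    have e2 : n * (n / (n - 2) - 1) / 2 = n / (n - 2) := by rw [e1]; ring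
    have hR : 1 < n / (n - 2) := by rw [one_lt_div (by linarith)]; linarith
    let K : ℝ≥0 := SNormLESNormFDerivOfEqConst ℝ (volume : Measure E) 2
    let p' : ℝ≥0 := ⟨2 * (n / (n - 2)), by linarith⟩
    have hp'r : (p' : ℝ) = 2 * (n / (n - 2)) := rfl
    have hp' : p' ≠ 0 := by
      intro h
      have := congrArg NNReal.toReal h
      rw [hp'r] at this
      simp only [NNReal.coe_zero] at this
      linarith
    refine ⟨n / (n - 2), K ^ (p' : ℝ), hR, e2.le, ?_, fun g hg hgs => ?_⟩
    · rw [e1]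
      rw [div_le_one (by apply _root_.mul_pos; linarith; apply div_pos <;> linarith)]
      rw [← mul_div_assoc, ← mul_div_assoc, div_le_div_iff_of_pos_right (by linarith)]
      linarith
    · rw [e2, sub_self, ENNReal.rpow_zero, mul_one]
      have hsob := eLpNorm_le_eLpNorm_fderiv_of_eq (volume : Measure E) hg hgs (p := 2)
        (p' := p') (by norm_num) (by omega) (by
          rw [hp'r, ← hn]
          have : n - 2 ≠ 0 := by linarith
          have : n ≠ 0 := by linarith
          change (2 * (n / (n - 2)))⁻¹ = (2 : ℝ)⁻¹ - n⁻¹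
          field_simp)
      have h3 := eLpNorm_nnreal_pow_eq_lintegral (μ := (volume : Measure E)) (f := g) hp'
      have h4 := eLpNorm_nnreal_pow_eq_lintegral (μ := (volume : Measure E))
        (f := fderiv ℝ g) (p := 2) (by norm_num)
      simp only [NNReal.coe_ofNat, ENNReal.rpow_ofNat] at h4
      have h5 := ENNReal.rpow_le_rpow hsob (z := p') (by positivity)
      rw [h3, ENNReal.mul_rpow_of_nonneg _ _ (by positivity)] at h5
      calc ∫⁻ x, (‖g x‖ₑ ^ 2) ^ (n / (n - 2)) = ∫⁻ x, ‖g x‖ₑ ^ (p' : ℝ) := by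
            refine lintegral_congr fun x => ?_
            rw [hp'r, ENNReal.rpow_mul, ENNReal.rpow_ofNat]
        _ ≤ _ := h5
        _ = _ := by
            congr 1
            · rw [ENNReal.coe_rpow_of_nonneg _ (by positivity)]; rfl
            · rw [hp'r, ENNReal.rpow_mul, ← h4, ENNReal.rpow_ofNat]

/-- Interpolation: a weight in `L^{l/2}`, `l > n`, is relatively form bounded with respect to
the Dirichlet form, and the power of the weight in the remainder is the scaling invariant one. -/
lemma exists_lintegral_weight_mul_sq_le (hE : 2 ≤ Module.finrank ℝ E) {l q : ℝ}
    (hl : (Module.finrank ℝ E : ℝ) < l) (hq : 2 < q)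
    (hlq : (Module.finrank ℝ E : ℝ) / l + 2 / q = 1) :
    ∃ C : ℝ≥0, ∀ g : E → ℝ, ContDiff ℝ 1 g → HasCompactSupport g →
      ∀ f : E → ℝ≥0∞, AEMeasurable f →
        ∫⁻ x, f x * ‖g x‖ₑ ^ 2 ≤
          (∫⁻ x, ‖fderiv ℝ g x‖ₑ ^ 2) +
            C * (∫⁻ x, f x ^ (l / 2)) ^ (q / l) * ∫⁻ x, ‖g x‖ₑ ^ 2 := by
  obtain ⟨R, D, hR, hβ, hb, hD⟩ := exists_lintegral_rpow_le hE hl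
  set n : ℝ := ((Module.finrank ℝ E : ℕ) : ℝ) with hn
  have hn2 : (2 : ℝ) ≤ n := by rw [hn]; exact_mod_cast hE
  have hl0 : 0 < l := by linarith
  have hR0 : 0 < R := by linarith
  have hR1 : 0 < R - 1 := by linarith
  have hq0 : 0 < q := by linarith
  set b : ℝ := 2 * R / (l * (R - 1)) with hbdef
  have hb0 : 0 ≤ b := by positivity
  refine ⟨D ^ (b / R * (q / 2)), fun g hg hgs f hf => ?_⟩
  set A := ∫⁻ x, ‖g x‖ₑ ^ 2
  set B := ∫⁻ x, ‖fderiv ℝ g x‖ₑ ^ 2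
  set F := ∫⁻ x, f x ^ (l / 2)
  have hgm : AEMeasurable (fun x => ‖g x‖ₑ ^ 2) := (hg.continuous.enorm.measurable.pow_const _).aemeasurable
  have hol := ENNReal.lintegral_prod_norm_pow_le (μ := (volume : Measure E))
    (Finset.univ : Finset (Fin 3))
    (f := ![fun x => f x ^ (l / 2), fun x => ‖g x‖ₑ ^ 2, fun x => (‖g x‖ₑ ^ 2) ^ R])
    (by
      intro i _
      fin_cases i
      · exact hf.pow_const _
      · exact hgm
      · exact hgm.pow_const _)
    (p := ![2 / l, 1 - b, b / R])
    (by
      simp only [Fin.sum_univ_three, Matrix.cons_val_zero, Matrix.cons_val_one, Matrix.cons_val]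
      rw [hbdef]; field_simp; ring)
    (by
      intro i _
      fin_cases i
      · simp; positivity
      · simpa using hb
      · simp; positivity)
  simp only [Fin.prod_univ_three, Matrix.cons_val_zero, Matrix.cons_val_one,
    Matrix.cons_val] at hol
  have hexp1 : 0 ≤ (R - n * (R - 1) / 2) * (b / R) := by
    apply mul_nonneg <;> [linarith; positivity]
  have eA : 1 - b + (R - n * (R - 1) / 2) * (b / R) = 2 / q := by
    have : 2 / q = 1 - n / l := by linarith
    rw [this, hbdef]; field_simp; ring
  have eB : n * (R - 1) / 2 * (b / R) = n / l := by
    rw [hbdef]; field_simp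
  have young := ENNReal.young_inequality ((D ^ (b / R * (q / 2)) * F ^ (q / l) * A) ^ (2 / q))
    (B ^ (n / l)) (p := q / 2) (q := l / n) (by
      rw [Real.holderConjugate_iff]
      constructor
      · linarith
      · rw [inv_div, inv_div]; linarith)
  calc ∫⁻ x, f x * ‖g x‖ₑ ^ 2
      = ∫⁻ x, (f x ^ (l / 2)) ^ (2 / l) * (‖g x‖ₑ ^ 2) ^ (1 - b) *
          ((‖g x‖ₑ ^ 2) ^ R) ^ (b / R) := by
        refine lintegral_congr fun x => ?_
        rw [← ENNReal.rpow_mul, ← ENNReal.rpow_mul, mul_assoc,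
          ← ENNReal.rpow_add_of_nonneg _ _ (by linarith) (by positivity)]
        have e1 : l / 2 * (2 / l) = 1 := by field_simp
        have e2 : 1 - b + R * (b / R) = 1 := by field_simp; ring
        rw [e1, e2, ENNReal.rpow_one, ENNReal.rpow_one]
    _ ≤ F ^ (2 / l) * A ^ (1 - b) * (∫⁻ x, (‖g x‖ₑ ^ 2) ^ R) ^ (b / R) := hol
    _ ≤ F ^ (2 / l) * A ^ (1 - b) *
          (D * A ^ (R - n * (R - 1) / 2) * B ^ (n * (R - 1) / 2)) ^ (b / R) := by
        gcongr
        exact hD g hg hgs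
    _ = (D ^ (b / R * (q / 2)) * F ^ (q / l) * A) ^ (2 / q) * B ^ (n / l) := by
        have h0 : 0 ≤ b / R := by positivity
        have h1 : 0 ≤ 2 / q := by positivity
        rw [ENNReal.mul_rpow_of_nonneg _ _ h0, ENNReal.mul_rpow_of_nonneg _ _ h0,
          ENNReal.mul_rpow_of_nonneg _ _ h1, ENNReal.mul_rpow_of_nonneg _ _ h1,
          ← ENNReal.rpow_mul, ← ENNReal.rpow_mul, ← ENNReal.rpow_mul, ← ENNReal.rpow_mul, eB,
          ← eA, ENNReal.rpow_add_of_nonneg _ _ (by linarith) hexp1, eA]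
        have e1 : b / R * (q / 2) * (2 / q) = b / R := by field_simp
        have e2 : q / l * (2 / q) = 2 / l := by field_simp
        rw [e1, e2]
        ring
    _ ≤ _ := young
    _ ≤ D ^ (b / R * (q / 2)) * F ^ (q / l) * A + B := by
        rw [← ENNReal.rpow_mul, ← ENNReal.rpow_mul]
        have e1 : 2 / q * (q / 2) = 1 := by field_simp
        have e2 : n / l * (l / n) = 1 := by field_simp
        rw [e1, e2, ENNReal.rpow_one, ENNReal.rpow_one]
        gcongr
        · refine ENNReal.div_le_of_le_mul (le_mul_of_one_le_right' ?_)
          exact ENNReal.one_le_ofReal.2 (by linarith)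
        · refine ENNReal.div_le_of_le_mul (le_mul_of_one_le_right' ?_)
          exact ENNReal.one_le_ofReal.2 (by rw [one_le_div (by linarith)]; linarith)
    _ = _ := by
        rw [add_comm, ENNReal.coe_rpow_of_nonneg _ (by positivity)]

end GagliardoNirenberg

section SpatialEstimates

variable {n k : ℕ}

/-- Squared length of the gradient of a function on `ℝⁿ`. -/
def spatialGradSq (g : Sp n → ℝ) (x : Sp n) : ℝ :=
  ∑ α : Fin n, (fderiv ℝ g x (EuclideanSpace.single α 1)) ^ 2

lemma norm_sq_le_sum_sq_apply_single (L : Sp n →L[ℝ] ℝ) :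
    ‖L‖ ^ 2 ≤ ∑ α : Fin n, (L (EuclideanSpace.single α 1)) ^ 2 := by
  set S := ∑ α : Fin n, (L (EuclideanSpace.single α 1)) ^ 2 with hS
  have hS0 : 0 ≤ S := Finset.sum_nonneg fun _ _ => sq_nonneg _
  refine (Real.le_sqrt (norm_nonneg _) hS0).1 (L.opNorm_le_bound (Real.sqrt_nonneg _) fun v => ?_)
  have hv : L v = ∑ α : Fin n, v α * L (EuclideanSpace.single α 1) := by
    conv_lhs => rw [← (EuclideanSpace.basisFun (Fin n) ℝ).sum_repr v]
    simp [map_sum]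
  rw [hv, EuclideanSpace.norm_eq, Real.norm_eq_abs, ← Real.sqrt_mul hS0]
  apply Real.abs_le_sqrt
  have := Finset.sum_mul_sq_le_sq_mul_sq Finset.univ (fun α => v α)
    (fun α => L (EuclideanSpace.single α 1))
  simp only [Real.norm_eq_abs, sq_abs]
  linarith

lemma HasCompactSupport.fun_sq {X : Type*} [TopologicalSpace X] {g : X → ℝ}
    (hg : HasCompactSupport g) : HasCompactSupport fun x => g x ^ 2 :=
  hg.comp_left (g := fun t : ℝ => t ^ 2) (by simp)

lemma ContDiff.continuous_spatialGradSq {g : Sp n → ℝ} (hg : ContDiff ℝ 1 g) :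
    Continuous (spatialGradSq g) := by
  unfold spatialGradSq
  have := hg.continuous_fderiv one_ne_zero
  fun_prop

lemma HasCompactSupport.spatialGradSq {g : Sp n → ℝ} (hg : HasCompactSupport g) :
    HasCompactSupport (spatialGradSq g) := by
  refine (hg.fderiv ℝ).mono fun x hx => ?_
  rw [Function.mem_support] at hx ⊢
  contrapose! hx
  simp [_root_.spatialGradSq, hx]

/-- The weighted form bound of `exists_lintegral_weight_mul_sq_le`, for continuous weights and in
terms of Bochner integrals. -/
lemma exists_integral_weight_mul_sq_le (hn : 2 ≤ n) {l q : ℝ}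
    (hl : (n : ℝ) < l) (hq : 2 < q) (hlq : (n : ℝ) / l + 2 / q = 1) :
    ∃ C : ℝ≥0, ∀ g : Sp n → ℝ, ContDiff ℝ 1 g → HasCompactSupport g →
      ∀ f : Sp n → ℝ, Continuous f → (∀ x, 0 ≤ f x) →
        (∫⁻ x, ENNReal.ofReal (f x ^ (l / 2))) ^ (q / l) ≠ ⊤ →
        ∫ x, f x * g x ^ 2 ≤ (∫ x, spatialGradSq g x) +
          C * ((∫⁻ x, ENNReal.ofReal (f x ^ (l / 2))) ^ (q / l)).toReal * ∫ x, g x ^ 2 := by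
  have hfr : Module.finrank ℝ (Sp n) = n := finrank_euclideanSpace_fin
  obtain ⟨C, hC⟩ := exists_lintegral_weight_mul_sq_le (E := Sp n) (l := l) (q := q)
    (by rw [hfr]; exact hn) (by rw [hfr]; exact hl) hq (by rw [hfr]; exact hlq)
  refine ⟨C, fun g hg hgs f hf hf0 hF => ?_⟩
  have hl0 : 0 < l := (Nat.cast_nonneg n).trans_lt hl
  have key := hC g hg hgs (fun x => ENNReal.ofReal (f x)) hf.measurable.ennreal_ofReal.aemeasurable
  simp_rw [fun x => ENNReal.ofReal_rpow_of_nonneg (hf0 x) (half_pos hl0).le] at key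
  set A := (∫⁻ x, ENNReal.ofReal (f x ^ (l / 2))) ^ (q / l)
  have hsq : ∀ t : ℝ, ‖t‖ₑ ^ 2 = ENNReal.ofReal (t ^ 2) := by
    intro t
    rw [Real.enorm_eq_ofReal_abs, ← ENNReal.ofReal_pow (abs_nonneg _), sq_abs]
  have hg2i : Integrable fun x => g x ^ 2 :=
    Continuous.integrable_of_hasCompactSupport (hg.continuous.pow 2)
      hgs.fun_sq
  have hfgi : Integrable fun x => f x * g x ^ 2 :=
    Continuous.integrable_of_hasCompactSupport (hf.mul (hg.continuous.pow 2))
      (hgs.fun_sq.mul_left (f := f))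
  have hgri : Integrable (spatialGradSq g) :=
    hg.continuous_spatialGradSq.integrable_of_hasCompactSupport hgs.spatialGradSq
  have hgr0 : ∀ x, 0 ≤ spatialGradSq g x := fun x => Finset.sum_nonneg fun _ _ => sq_nonneg _
  have e1 : ∫⁻ x, ENNReal.ofReal (f x) * ‖g x‖ₑ ^ 2 = ENNReal.ofReal (∫ x, f x * g x ^ 2) := by
    rw [ofReal_integral_eq_lintegral_ofReal hfgi
      (Eventually.of_forall fun x => mul_nonneg (hf0 x) (sq_nonneg _))]
    exact lintegral_congr fun x => by rw [hsq, ENNReal.ofReal_mul (hf0 x)]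
  have e2 : ∫⁻ x, ‖g x‖ₑ ^ 2 = ENNReal.ofReal (∫ x, g x ^ 2) := by
    rw [ofReal_integral_eq_lintegral_ofReal hg2i (Eventually.of_forall fun x => sq_nonneg _)]
    exact lintegral_congr fun x => hsq _
  have e3 : ∫⁻ x, ‖fderiv ℝ g x‖ₑ ^ 2 ≤ ENNReal.ofReal (∫ x, spatialGradSq g x) := by
    rw [ofReal_integral_eq_lintegral_ofReal hgri (Eventually.of_forall hgr0)]
    refine lintegral_mono fun x => ?_
    rw [← ofReal_norm, ← ENNReal.ofReal_pow (norm_nonneg _)]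
    exact ENNReal.ofReal_le_ofReal (norm_sq_le_sum_sq_apply_single _)
  rw [e1, e2] at key
  have hi1 : 0 ≤ ∫ x, spatialGradSq g x := integral_nonneg hgr0
  have hi2 : 0 ≤ ∫ x, g x ^ 2 := integral_nonneg fun x => sq_nonneg _
  have key2 := key.trans (add_le_add_left e3 _)
  rw [← ENNReal.ofReal_toReal hF, ← ENNReal.ofReal_coe_nnreal, ← ENNReal.ofReal_mul C.coe_nonneg,
    ← ENNReal.ofReal_mul (by positivity), ← ENNReal.ofReal_add hi1 (by positivity)] at key2
  exact (ENNReal.ofReal_le_ofReal_iff (by positivity)).1 key2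

/-- Integration by parts against a cut-off function, written so that no cross term appears. -/
lemma integral_cutoff_mul_second_deriv {W η : Sp n → ℝ} (hW : ContDiff ℝ 2 W)
    (hη : ContDiff ℝ 2 η) (hs : HasCompactSupport η) (v : Sp n) :
    ∫ x, 2 * η x ^ 2 * W x * fderiv ℝ (fun y => fderiv ℝ W y v) x v =
      (∫ x, 2 * (fderiv ℝ η x v) ^ 2 * W x ^ 2) -
        ∫ x, 2 * (fderiv ℝ (fun y => η y * W y) x v) ^ 2 := by
  have hWd : Differentiable ℝ W := hW.differentiable two_ne_zero
  have hηd : Differentiable ℝ η := hη.differentiable two_ne_zero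
  have hW1 : ContDiff ℝ 1 fun y => fderiv ℝ W y v :=
    (hW.fderiv_right (m := 1) (by norm_num)).clm_apply contDiff_const
  have hη1 : ContDiff ℝ 1 fun y => fderiv ℝ η y v :=
    (hη.fderiv_right (m := 1) (by norm_num)).clm_apply contDiff_const
  have hW2 : Continuous fun x => fderiv ℝ (fun y => fderiv ℝ W y v) x v :=
    (hW1.continuous_fderiv one_ne_zero).clm_apply continuous_const
  have cW := hW.continuous
  have cη := hη.continuous
  have cW1 := hW1.continuous
  have cη1 := hη1.continuous
  have hs1 : HasCompactSupport fun y => fderiv ℝ η y v := hs.fderiv_apply (𝕜 := ℝ) v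
  have hint : ∀ h : Sp n → ℝ, Continuous h → Integrable fun x => η x * h x := fun h hh =>
    (cη.mul hh).integrable_of_hasCompactSupport hs.mul_right
  have hfd : ∀ x, fderiv ℝ (fun y => 2 * η y ^ 2 * W y) x v =
      4 * η x * fderiv ℝ η x v * W x + 2 * η x ^ 2 * fderiv ℝ W x v := by
    intro x
    have h1 := ((((hηd x).hasFDerivAt.pow 2).const_mul 2).mul (hWd x).hasFDerivAt).fderiv
    rw [show (fun y => 2 * η y ^ 2 * W y) = (fun y => 2 * η y ^ 2) * W from rfl, h1]
    simp
    ring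
  have hfd2 : ∀ x, fderiv ℝ (fun y => η y * W y) x v =
      η x * fderiv ℝ W x v + W x * fderiv ℝ η x v := by
    intro x
    rw [fderiv_fun_mul (hηd x) (hWd x)]
    simp
  have hparts := integral_mul_fderiv_eq_neg_fderiv_mul_of_integrable (μ := (volume : Measure (Sp n)))
    (f := fun y => 2 * η y ^ 2 * W y) (g := fun y => fderiv ℝ W y v) (v := v)
    (by
      simp_rw [hfd]
      refine (hint (fun x => (4 * fderiv ℝ η x v * W x + 2 * η x * fderiv ℝ W x v) *
        fderiv ℝ W x v) (by fun_prop)).congr (Eventually.of_forall fun x => ?_)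
      simp only; ring)
    (by
      refine (hint (fun x => 2 * η x * W x * fderiv ℝ (fun y => fderiv ℝ W y v) x v)
        (by fun_prop)).congr (Eventually.of_forall fun x => ?_)
      simp only; ring)
    (by
      refine (hint (fun x => 2 * η x * W x * fderiv ℝ W x v)
        (by fun_prop)).congr (Eventually.of_forall fun x => ?_)
      simp only; ring)
    (fun x _ => ((hηd x).pow 2 |>.const_mul 2).mul (hWd x))
    (fun x _ => hW1.differentiable one_ne_zero x)
  have i1 : Integrable fun x => 2 * (fderiv ℝ η x v) ^ 2 * W x ^ 2 := by
    refine Continuous.integrable_of_hasCompactSupport (by fun_prop) ?_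
    refine hs1.mono fun x hx => ?_
    rw [Function.mem_support] at hx ⊢
    contrapose! hx
    simp [hx]
  have i2 : Integrable fun x => 2 * (fderiv ℝ (fun y => η y * W y) x v) ^ 2 := by
    simp_rw [hfd2]
    refine (i1.add (hint (fun x => 2 * η x * fderiv ℝ W x v ^ 2 +
      4 * W x * fderiv ℝ η x v * fderiv ℝ W x v)
        (by fun_prop))).congr (Eventually.of_forall fun x => ?_)
    simp only [Pi.add_apply]; ring
  rw [hparts, ← integral_sub i1 i2, ← integral_neg]
  refine integral_congr_ae (Eventually.of_forall fun x => ?_)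
  simp only [hfd, hfd2]
  ring

/-- The spatial energy estimate for the difference of two sphere-valued maps. -/
lemma integral_cutoff_mul_difference_le {C l q : ℝ}
    (hC : ∀ g : Sp n → ℝ, ContDiff ℝ 1 g → HasCompactSupport g →
      ∀ f : Sp n → ℝ, Continuous f → (∀ x, 0 ≤ f x) →
        (∫⁻ x, ENNReal.ofReal (f x ^ (l / 2))) ^ (q / l) ≠ ⊤ →
        ∫ x, f x * g x ^ 2 ≤ (∫ x, spatialGradSq g x) +
          C * ((∫⁻ x, ENNReal.ofReal (f x ^ (l / 2))) ^ (q / l)).toReal * ∫ x, g x ^ 2)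
    {a b τ : Fin k → Sp n → ℝ} {f₁ f₂ η : Sp n → ℝ}
    (ha : ∀ i, ContDiff ℝ 2 (a i)) (hb : ∀ i, ContDiff ℝ 2 (b i))
    (hsa : ∀ x, ∑ i, a i x ^ 2 = 1) (hsb : ∀ x, ∑ i, b i x ^ 2 = 1)
    (hf₁ : Continuous f₁) (hf₂ : Continuous f₂) (hf₁0 : ∀ x, 0 ≤ f₁ x) (hf₂0 : ∀ x, 0 ≤ f₂ x)
    (hF₁ : (∫⁻ x, ENNReal.ofReal (f₁ x ^ (l / 2))) ^ (q / l) ≠ ⊤)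
    (hF₂ : (∫⁻ x, ENNReal.ofReal (f₂ x ^ (l / 2))) ^ (q / l) ≠ ⊤)
    (hτ : ∀ i x, τ i x =
      ((∑ α : Fin n, fderiv ℝ (fun y => fderiv ℝ (a i) y (EuclideanSpace.single α 1)) x
        (EuclideanSpace.single α 1)) + f₁ x * a i x) -
      ((∑ α : Fin n, fderiv ℝ (fun y => fderiv ℝ (b i) y (EuclideanSpace.single α 1)) x
        (EuclideanSpace.single α 1)) + f₂ x * b i x))
    (hη : ContDiff ℝ 2 η) (hs : HasCompactSupport η) :
    ∫ x, η x ^ 2 * ∑ i, 2 * (a i x - b i x) * τ i x ≤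
      (∫ x, 2 * spatialGradSq η x * ∑ i, (a i x - b i x) ^ 2) +
      C * (((∫⁻ x, ENNReal.ofReal (f₁ x ^ (l / 2))) ^ (q / l)).toReal +
        ((∫⁻ x, ENNReal.ofReal (f₂ x ^ (l / 2))) ^ (q / l)).toReal) *
        ∫ x, η x ^ 2 * ∑ i, (a i x - b i x) ^ 2 := by
  set A₁ := ((∫⁻ x, ENNReal.ofReal (f₁ x ^ (l / 2))) ^ (q / l)).toReal with hA₁
  set A₂ := ((∫⁻ x, ENNReal.ofReal (f₂ x ^ (l / 2))) ^ (q / l)).toReal with hA₂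
  let W : Fin k → Sp n → ℝ := fun i x => a i x - b i x
  have hW : ∀ i, ContDiff ℝ 2 (W i) := fun i => (ha i).sub (hb i)
  let e : Fin n → Sp n := fun α => EuclideanSpace.single α 1
  have hd2 : ∀ i α x, fderiv ℝ (fun y => fderiv ℝ (W i) y (e α)) x (e α) =
      fderiv ℝ (fun y => fderiv ℝ (a i) y (e α)) x (e α) -
        fderiv ℝ (fun y => fderiv ℝ (b i) y (e α)) x (e α) := by
    intro i α x
    have ha1 : ContDiff ℝ 1 fun y => fderiv ℝ (a i) y (e α) :=
      ((ha i).fderiv_right (m := 1) (by norm_num)).clm_apply contDiff_const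
    have hb1 : ContDiff ℝ 1 fun y => fderiv ℝ (b i) y (e α) :=
      ((hb i).fderiv_right (m := 1) (by norm_num)).clm_apply contDiff_const
    have : (fun y => fderiv ℝ (W i) y (e α)) =
        fun y => fderiv ℝ (a i) y (e α) - fderiv ℝ (b i) y (e α) := by
      funext y
      simp only [W]
      rw [fderiv_fun_sub ((ha i).differentiable two_ne_zero y)
        ((hb i).differentiable two_ne_zero y)]
      simp
    rw [this, fderiv_fun_sub (ha1.differentiable one_ne_zero x)
      (hb1.differentiable one_ne_zero x)]
    simp
  have cη := hη.continuous
  have cW : ∀ i, Continuous (W i) := fun i => (hW i).continuous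
  have cW2 : ∀ i α, Continuous fun x => fderiv ℝ (fun y => fderiv ℝ (W i) y (e α)) x (e α) := by
    intro i α
    have : ContDiff ℝ 1 fun y => fderiv ℝ (W i) y (e α) :=
      ((hW i).fderiv_right (m := 1) (by norm_num)).clm_apply contDiff_const
    exact (this.continuous_fderiv one_ne_zero).clm_apply continuous_const
  have hint : ∀ h : Sp n → ℝ, Continuous h → Integrable fun x => η x ^ 2 * h x := fun h hh =>
    Continuous.integrable_of_hasCompactSupport ((cη.pow 2).mul hh)
      (hs.fun_sq.mul_right (f' := h))
  have hpt : ∀ x, η x ^ 2 * ∑ i, 2 * (a i x - b i x) * τ i x =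
      (∑ i, ∑ α, 2 * η x ^ 2 * W i x * fderiv ℝ (fun y => fderiv ℝ (W i) y (e α)) x (e α)) +
      ((∑ i, f₁ x * (η x * W i x) ^ 2) + ∑ i, f₂ x * (η x * W i x) ^ 2) := by
    intro x
    have hab : ∑ i, W i x ^ 2 = 2 - 2 * ∑ i, a i x * b i x := by
      have : ∀ i, W i x ^ 2 = a i x ^ 2 + b i x ^ 2 - 2 * (a i x * b i x) := fun i => by
        simp only [W]; ring
      simp_rw [this]
      rw [Finset.sum_sub_distrib, Finset.sum_add_distrib, hsa, hsb, ← Finset.mul_sum]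
      ring
    have h1 : ∀ i, 2 * (a i x - b i x) * τ i x =
        (∑ α, 2 * W i x * fderiv ℝ (fun y => fderiv ℝ (W i) y (e α)) x (e α)) +
        (f₁ x * (2 * a i x ^ 2 - 2 * (a i x * b i x)) +
          f₂ x * (2 * b i x ^ 2 - 2 * (a i x * b i x))) := by
      intro i
      rw [← Finset.mul_sum, hτ]
      simp_rw [hd2]
      rw [Finset.sum_sub_distrib]
      simp only [W, e]
      ring
    simp_rw [h1]
    rw [Finset.sum_add_distrib, Finset.sum_add_distrib, ← Finset.mul_sum, ← Finset.mul_sum,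
      Finset.sum_sub_distrib, Finset.sum_sub_distrib, ← Finset.mul_sum, ← Finset.mul_sum,
      ← Finset.mul_sum, hsa, hsb]
    have h2 : ∀ f : ℝ, ∑ i, f * (η x * W i x) ^ 2 =
        η x ^ 2 * (f * (2 - 2 * ∑ i, a i x * b i x)) := by
      intro f
      rw [← hab, Finset.mul_sum, Finset.mul_sum]
      exact Finset.sum_congr rfl fun i _ => by ring
    rw [h2, h2, mul_add, mul_add, Finset.mul_sum]
    congr 1
    · refine Finset.sum_congr rfl fun i _ => ?_
      rw [Finset.mul_sum]
      exact Finset.sum_congr rfl fun α _ => by ring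
    · ring
  have I1 : ∀ i α, Integrable fun x =>
      2 * η x ^ 2 * W i x * fderiv ℝ (fun y => fderiv ℝ (W i) y (e α)) x (e α) := by
    intro i α
    refine (hint (fun x => 2 * W i x * fderiv ℝ (fun y => fderiv ℝ (W i) y (e α)) x (e α))
      (by have := cW i; have := cW2 i α; fun_prop)).congr (Eventually.of_forall fun x => ?_)
    simp only; ring
  have I2 : ∀ f : Sp n → ℝ, Continuous f → ∀ i, Integrable fun x => f x * (η x * W i x) ^ 2 := by
    intro f hf i
    refine (hint (fun x => f x * W i x ^ 2)
      (by have := cW i; fun_prop)).congr (Eventually.of_forall fun x => ?_)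
    simp only; ring
  have hg : ∀ i, ContDiff ℝ 2 fun x => η x * W i x := fun i => hη.mul (hW i)
  have hgs : ∀ i, HasCompactSupport fun x => η x * W i x := fun i => hs.mul_right
  have hw : ∀ f : Sp n → ℝ, Continuous f → (∀ x, 0 ≤ f x) →
      (∫⁻ x, ENNReal.ofReal (f x ^ (l / 2))) ^ (q / l) ≠ ⊤ →
      ∑ i, ∫ x, f x * (η x * W i x) ^ 2 ≤
        (∑ i, ∫ x, spatialGradSq (fun y => η y * W i y) x) +
        C * ((∫⁻ x, ENNReal.ofReal (f x ^ (l / 2))) ^ (q / l)).toReal *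
          ∑ i, ∫ x, (η x * W i x) ^ 2 := by
    intro f hf hf0 hF
    rw [Finset.mul_sum, ← Finset.sum_add_distrib]
    exact Finset.sum_le_sum fun i _ =>
      hC _ ((hg i).of_le (by norm_num)) (hgs i) f hf hf0 hF
  have hG : ∫ x, η x ^ 2 * ∑ i, (a i x - b i x) ^ 2 = ∑ i, ∫ x, (η x * W i x) ^ 2 := by
    rw [← integral_finsetSum _ fun i _ => by
      simpa using I2 (fun _ => 1) continuous_const i]
    refine integral_congr_ae (Eventually.of_forall fun x => ?_)
    simp only [Finset.mul_sum, mul_pow, W]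
  have hparts : ∑ i, ∑ α, ∫ x,
      2 * η x ^ 2 * W i x * fderiv ℝ (fun y => fderiv ℝ (W i) y (e α)) x (e α) =
      (∫ x, 2 * spatialGradSq η x * ∑ i, (a i x - b i x) ^ 2) -
        2 * ∑ i, ∫ x, spatialGradSq (fun y => η y * W i y) x := by
    simp_rw [fun i α => integral_cutoff_mul_second_deriv (hW i) hη hs (e α)]
    simp_rw [Finset.sum_sub_distrib]
    congr 1
    · have J : ∀ i α, Integrable fun x => 2 * (fderiv ℝ η x (e α)) ^ 2 * W i x ^ 2 := by
        intro i α
        have c1 : Continuous fun x => fderiv ℝ η x (e α) :=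
          (hη.continuous_fderiv two_ne_zero).clm_apply continuous_const
        refine Continuous.integrable_of_hasCompactSupport
          (by have := cW i; fun_prop) ?_
        refine (hs.fderiv_apply (𝕜 := ℝ) (e α)).mono fun x hx => ?_
        rw [Function.mem_support] at hx ⊢
        contrapose! hx
        simp [hx]
      simp_rw [fun i => (integral_finsetSum Finset.univ fun α _ => J i α).symm]
      rw [← integral_finsetSum _ fun i _ => integrable_finsetSum _ fun α _ => J i α]
      refine integral_congr_ae (Eventually.of_forall fun x => ?_)
      simp only [spatialGradSq, Finset.mul_sum, W, e, Finset.sum_mul]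
    · rw [Finset.mul_sum]
      refine Finset.sum_congr rfl fun i _ => ?_
      have J : ∀ α, Integrable fun x => 2 * (fderiv ℝ (fun y => η y * W i y) x (e α)) ^ 2 := by
        intro α
        have c1 : Continuous fun x => fderiv ℝ (fun y => η y * W i y) x (e α) :=
          ((hg i).continuous_fderiv two_ne_zero).clm_apply continuous_const
        refine Continuous.integrable_of_hasCompactSupport (by fun_prop) ?_
        refine ((hgs i).fderiv_apply (𝕜 := ℝ) (e α)).mono fun x hx => ?_
        rw [Function.mem_support] at hx ⊢
        contrapose! hx
        simp [hx]
      rw [← integral_finsetSum _ fun α _ => J α, ← integral_const_mul]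
      refine integral_congr_ae (Eventually.of_forall fun x => ?_)
      simp only [spatialGradSq, Finset.mul_sum, e]
  have hL : ∫ x, η x ^ 2 * ∑ i, 2 * (a i x - b i x) * τ i x =
      (∑ i, ∑ α, ∫ x,
        2 * η x ^ 2 * W i x * fderiv ℝ (fun y => fderiv ℝ (W i) y (e α)) x (e α)) +
      ((∑ i, ∫ x, f₁ x * (η x * W i x) ^ 2) + ∑ i, ∫ x, f₂ x * (η x * W i x) ^ 2) := by
    simp_rw [hpt]
    have S1 : Integrable fun x => ∑ i, ∑ α,
        2 * η x ^ 2 * W i x * fderiv ℝ (fun y => fderiv ℝ (W i) y (e α)) x (e α) :=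
      integrable_finsetSum _ fun i _ => integrable_finsetSum _ fun α _ => I1 i α
    have S2 : ∀ f : Sp n → ℝ, Continuous f → Integrable fun x => ∑ i, f x * (η x * W i x) ^ 2 :=
      fun f hf => integrable_finsetSum _ fun i _ => I2 f hf i
    have S3 : Integrable fun x =>
        (∑ i, f₁ x * (η x * W i x) ^ 2) + ∑ i, f₂ x * (η x * W i x) ^ 2 :=
      (S2 f₁ hf₁).add (S2 f₂ hf₂)
    rw [integral_add S1 S3, integral_add (S2 f₁ hf₁) (S2 f₂ hf₂),
      integral_finsetSum _ fun i _ => integrable_finsetSum _ fun α _ => I1 i α,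
      integral_finsetSum _ fun i _ => I2 f₁ hf₁ i, integral_finsetSum _ fun i _ => I2 f₂ hf₂ i]
    simp_rw [fun i => integral_finsetSum Finset.univ fun α _ => I1 i α]
  rw [hL, hparts, hG]
  have h1 := hw f₁ hf₁ hf₁0 hF₁
  have h2 := hw f₂ hf₂ hf₂0 hF₂
  rw [← hA₁] at h1
  rw [← hA₂] at h2
  linarith

end SpatialEstimates

section SpaceTime

variable {n k : ℕ}

lemma isOpen_openSlab (T : ℝ) : IsOpen {z : Sp n × ℝ | z.2 ∈ Ioo 0 T} :=
  isOpen_Ioo.preimage continuous_snd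

lemma hasFDerivAt_slice {v : Sp n × ℝ → ℝ} {x : Sp n} {t : ℝ}
    (hv : DifferentiableAt ℝ v (x, t)) :
    HasFDerivAt (fun y => v (y, t))
      ((fderiv ℝ v (x, t)).comp (ContinuousLinearMap.inl ℝ (Sp n) ℝ)) x :=
  HasFDerivAt.comp x hv.hasFDerivAt (hasFDerivAt_prodMk_left x t)

lemma fderiv_slice_apply {v : Sp n × ℝ → ℝ} {x : Sp n} {t : ℝ}
    (hv : DifferentiableAt ℝ v (x, t)) (e : Sp n) :
    fderiv ℝ (fun y => v (y, t)) x e = fderiv ℝ v (x, t) (e, 0) := by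
  rw [(hasFDerivAt_slice hv).fderiv]
  simp

lemma hasDerivAt_time {v : Sp n × ℝ → ℝ} {z : Sp n × ℝ} (hv : DifferentiableAt ℝ v z) :
    HasDerivAt (fun s => v (z.1, s)) (fderiv ℝ v z (tdir n)) z.2 := by
  exact HasFDerivAt.comp_hasDerivAt (f := fun s : ℝ => (z.1, s)) z.2 hv.hasFDerivAt
    ((hasDerivAt_const z.2 z.1).prodMk (hasDerivAt_id z.2))

lemma contDiff_slice {v : Sp n × ℝ → ℝ} {T t : ℝ}
    (hv : ContDiffOn ℝ (⊤ : ℕ∞) v {z | z.2 ∈ Ioo 0 T}) (ht : t ∈ Ioo 0 T) :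
    ContDiff ℝ 2 fun x => v (x, t) := by
  rw [contDiff_iff_contDiffAt]
  intro x
  have h1 : ContDiffAt ℝ 2 v (x, t) :=
    (hv.contDiffAt ((isOpen_openSlab T).mem_nhds ht)).of_le (WithTop.coe_le_coe.2 le_top)
  exact h1.comp x (contDiffAt_id.prodMk contDiffAt_const)

lemma contDiffOn_fderiv_apply {v : Sp n × ℝ → ℝ} {T : ℝ}
    (hv : ContDiffOn ℝ (⊤ : ℕ∞) v {z | z.2 ∈ Ioo 0 T}) (w : Sp n × ℝ) :
    ContDiffOn ℝ (⊤ : ℕ∞) (fun z => fderiv ℝ v z w) {z | z.2 ∈ Ioo 0 T} :=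
  (hv.fderiv_of_isOpen (isOpen_openSlab T) (by simp)).clm_apply contDiffOn_const

lemma differentiableAt_of_openSlab {v : Sp n × ℝ → ℝ} {T : ℝ}
    (hv : ContDiffOn ℝ (⊤ : ℕ∞) v {z | z.2 ∈ Ioo 0 T}) {z : Sp n × ℝ} (hz : z.2 ∈ Ioo 0 T) :
    DifferentiableAt ℝ v z :=
  (hv.contDiffAt ((isOpen_openSlab T).mem_nhds hz)).differentiableAt (by simp)

lemma fderiv_fderiv_slice_apply {v : Sp n × ℝ → ℝ} {T t : ℝ}
    (hv : ContDiffOn ℝ (⊤ : ℕ∞) v {z | z.2 ∈ Ioo 0 T}) (ht : t ∈ Ioo 0 T) (x e : Sp n) :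
    fderiv ℝ (fun y => fderiv ℝ (fun y' => v (y', t)) y e) x e =
      fderiv ℝ (fun z => fderiv ℝ v z (e, 0)) (x, t) (e, 0) := by
  have h1 : (fun y => fderiv ℝ (fun y' => v (y', t)) y e) =
      fun y => (fun z => fderiv ℝ v z (e, 0)) (y, t) :=
    funext fun y => fderiv_slice_apply (differentiableAt_of_openSlab hv ht) e
  rw [h1]
  exact fderiv_slice_apply
    (differentiableAt_of_openSlab (contDiffOn_fderiv_apply hv (e, 0)) ht) e

lemma continuous_slice {φ : Sp n × ℝ → ℝ} {J : Set ℝ}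
    (hφ : ContinuousOn φ {z | z.2 ∈ J}) {t : ℝ} (ht : t ∈ J) : Continuous fun x => φ (x, t) :=
  hφ.comp_continuous (by fun_prop) fun _ => ht

/-- Differentiation in time under the integral sign, against a spatial cut-off function. -/
lemma hasDerivAt_integral_cutoff {φ ψ : Sp n × ℝ → ℝ} {η : Sp n → ℝ} {T : ℝ}
    (hη : Continuous η) (hs : HasCompactSupport η)
    (hφ : ContinuousOn φ {z | z.2 ∈ Ioo 0 T}) (hψ : ContinuousOn ψ {z | z.2 ∈ Ioo 0 T})
    (hd : ∀ z : Sp n × ℝ, z.2 ∈ Ioo 0 T → HasDerivAt (fun s => φ (z.1, s)) (ψ z) z.2)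
    {t : ℝ} (ht : t ∈ Ioo 0 T) :
    HasDerivAt (fun s => ∫ x, η x ^ 2 * φ (x, s)) (∫ x, η x ^ 2 * ψ (x, t)) t := by
  obtain ⟨δ, hδ, hball⟩ := Metric.nhds_basis_closedBall.mem_iff.1 (isOpen_Ioo.mem_nhds ht)
  have hK : IsCompact (tsupport η ×ˢ closedBall t δ) :=
    IsCompact.prod hs (isCompact_closedBall t δ)
  obtain ⟨M, hM⟩ := hK.exists_bound_of_continuousOn (f := ψ)
    (hψ.mono fun z hz => hball hz.2)
  have hη2 : Continuous fun x => η x ^ 2 := hη.pow 2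
  refine (hasDerivAt_integral_of_dominated_loc_of_deriv_le (F := fun s x => η x ^ 2 * φ (x, s))
    (F' := fun s x => η x ^ 2 * ψ (x, s)) (bound := fun x => η x ^ 2 * M)
    (closedBall_mem_nhds t hδ) ?_ ?_ ?_ ?_ ?_ ?_).2
  · filter_upwards [isOpen_Ioo.mem_nhds ht] with s hs'
    exact (hη2.mul (continuous_slice hφ hs')).aestronglyMeasurable
  · exact Continuous.integrable_of_hasCompactSupport (hη2.mul (continuous_slice hφ ht))
      (hs.fun_sq.mul_right (f' := fun x => φ (x, t)))
  · exact (hη2.mul (continuous_slice hψ ht)).aestronglyMeasurable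
  · refine Eventually.of_forall fun x s hs' => ?_
    by_cases hx : x ∈ tsupport η
    · rw [norm_mul, Real.norm_of_nonneg (sq_nonneg _)]
      exact mul_le_mul_of_nonneg_left (hM (x, s) ⟨hx, hs'⟩) (sq_nonneg _)
    · simp [image_eq_zero_of_notMem_tsupport hx]
  · exact Continuous.integrable_of_hasCompactSupport (hη2.mul continuous_const)
      (hs.fun_sq.mul_right (f' := fun _ => M))
  · exact Eventually.of_forall fun x s hs' => (hd (x, s) (hball hs')).const_mul _

/-- A Grönwall inequality with integrable coefficient on an interval where the coefficient has
small integral. -/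
lemma le_of_deriv_le_add_mul {G G' F : ℝ → ℝ} {a b ε : ℝ} (hε : 0 ≤ ε)
    (hG : ContinuousOn G (Icc a b)) (hGa : G a = 0)
    (hG0 : ∀ t ∈ Icc a b, 0 ≤ G t)
    (hd : ∀ t ∈ Ioo a b, HasDerivAt G (G' t) t)
    (hF : IntegrableOn F (Icc a b)) (hF0 : ∀ t, 0 ≤ F t)
    (hle : ∀ᵐ t, t ∈ Ioo a b → G' t ≤ ε + F t * G t)
    (hsmall : ∫ t in a..b, F t ≤ 1 / 2) :
    ∀ t ∈ Icc a b, G t ≤ 2 * ε * (b - a) := by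
  intro t ht
  obtain ⟨m, hm, hmax⟩ := isCompact_Icc.exists_isMaxOn ⟨t, ht⟩ hG
  classical
  let φ : ℝ → ℝ := fun s => if G' s ≤ ε + F s * G m then ε + F s * G m else G' s
  have hsub : Icc a m ⊆ Icc a b := Icc_subset_Icc_right hm.2
  have hsub' : Ioo a m ⊆ Ioo a b := Ioo_subset_Ioo_right hm.2
  have hφ : ∀ᵐ s, s ∈ Ioo a b → φ s = ε + F s * G m := by
    filter_upwards [hle] with s hs hsab
    refine if_pos ((hs hsab).trans ?_)
    have := mul_le_mul_of_nonneg_left (hmax (Ioo_subset_Icc_self hsab)) (hF0 s)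
    simpa using this
  have hint : IntegrableOn (fun s => ε + F s * G m) (Icc a m) :=
    (integrableOn_const (by simp)).add ((hF.mono_set hsub).mul_const _)
  have hφ2 : (fun s => ε + F s * G m) =ᵐ[volume.restrict (Icc a m)] φ := by
    rw [← restrict_Ioo_eq_restrict_Icc]
    refine (ae_restrict_iff' measurableSet_Ioo).2 ?_
    filter_upwards [hφ] with s hs hsam using (hs (hsub' hsam)).symm
  have key := intervalIntegral.sub_le_integral_of_hasDeriv_right_of_le hm.1 (hG.mono hsub)
    (fun s hs => (hd s (hsub' hs)).hasDerivWithinAt) (φ := φ) (hint.congr hφ2)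
    (fun s _ => by
      simp only [φ]
      split_ifs with h
      · exact h
      · exact le_rfl)
  have hint1 : IntervalIntegrable F volume a m :=
    (intervalIntegrable_iff_integrableOn_Icc_of_le hm.1).2 (hF.mono_set hsub)
  have e1 : ∫ y in a..m, φ y = ε * (m - a) + (∫ y in a..m, F y) * G m := by
    rw [intervalIntegral.integral_of_le hm.1, ← integral_Icc_eq_integral_Ioc,
      ← integral_congr_ae hφ2, integral_Icc_eq_integral_Ioc,
      ← intervalIntegral.integral_of_le hm.1,
      intervalIntegral.integral_add (by simp) (hint1.mul_const _),
      intervalIntegral.integral_mul_const]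
    simp
    ring
  have e2 : ∫ y in a..m, F y ≤ 1 / 2 := by
    refine le_trans ?_ hsmall
    exact intervalIntegral.integral_mono_interval le_rfl hm.1 hm.2
      (Eventually.of_forall fun s => hF0 s)
      ((intervalIntegrable_iff_integrableOn_Icc_of_le (hm.1.trans hm.2)).2 hF)
  have hGm := hG0 m hm
  have e3 : G t ≤ G m := hmax ht
  have e4 : ε * (m - a) ≤ ε * (b - a) := mul_le_mul_of_nonneg_left (by linarith [hm.2]) hε
  rw [e1, hGa] at key
  nlinarith [mul_le_mul_of_nonneg_right e2 hGm]

end SpaceTime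

section EnergyBounds

variable {n k : ℕ}

lemma continuousOn_pd {u : Sp n × ℝ → Fin k → ℝ} {T : ℝ}
    (hu : ∀ i, ContDiffOn ℝ (⊤ : ℕ∞) (fun z => u z i) {z | z.2 ∈ Ioo 0 T}) (i : Fin k)
    (v : Sp n × ℝ) : ContinuousOn (pd u i v) {z | z.2 ∈ Ioo 0 T} :=
  (contDiffOn_fderiv_apply (hu i) v).continuousOn

lemma continuousOn_gradSq {u : Sp n × ℝ → Fin k → ℝ} {T : ℝ}
    (hu : ∀ i, ContDiffOn ℝ (⊤ : ℕ∞) (fun z => u z i) {z | z.2 ∈ Ioo 0 T}) :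
    ContinuousOn (gradSq u) {z | z.2 ∈ Ioo 0 T} :=
  continuousOn_finsetSum _ fun α _ => continuousOn_finsetSum _ fun i _ =>
    (continuousOn_pd hu i (sdir n α)).pow 2

lemma gradSq_nonneg (u : Sp n × ℝ → Fin k → ℝ) (z : Sp n × ℝ) : 0 ≤ gradSq u z :=
  Finset.sum_nonneg fun _ _ => Finset.sum_nonneg fun _ _ => sq_nonneg _

lemma integrableOn_toReal_gradMixedNorm {u : Sp n × ℝ → Fin k → ℝ} {T l q : ℝ}
    (hu : ∀ i, ContDiffOn ℝ (⊤ : ℕ∞) (fun z => u z i) {z | z.2 ∈ Ioo 0 T}) (hq : 0 < q)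
    (hfin : gradMixedNorm u 0 T l q < ⊤) :
    IntegrableOn (fun t => ((∫⁻ x : Sp n,
        ENNReal.ofReal (gradSq u (x, t) ^ (l / 2))) ^ (q / l)).toReal) (Icc 0 T) ∧
      ∀ᵐ t, t ∈ Ioo 0 T →
        (∫⁻ x : Sp n, ENNReal.ofReal (gradSq u (x, t) ^ (l / 2))) ^ (q / l) ≠ ⊤ := by
  have hmeas : AEMeasurable (fun t => (∫⁻ x : Sp n,
      ENNReal.ofReal (gradSq u (x, t) ^ (l / 2))) ^ (q / l)) (volume.restrict (Ioo 0 T)) := by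
    refine AEMeasurable.pow_const (AEMeasurable.lintegral_prod_left'
      (f := fun z => ENNReal.ofReal (gradSq u z ^ (l / 2))) (μ := (volume : Measure (Sp n))) ?_) _
    rw [← Measure.restrict_univ (μ := (volume : Measure (Sp n))), Measure.prod_restrict]
    have hset : (univ : Set (Sp n)) ×ˢ Ioo 0 T = {z : Sp n × ℝ | z.2 ∈ Ioo 0 T} := by
      ext z; simp
    rw [hset]
    exact (((continuousOn_gradSq hu).aemeasurable
      (isOpen_openSlab T).measurableSet).pow_const _).ennreal_ofReal
  have hne : ∫⁻ t in Ioo 0 T, (∫⁻ x : Sp n,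
      ENNReal.ofReal (gradSq u (x, t) ^ (l / 2))) ^ (q / l) ≠ ⊤ := by
    rw [restrict_Ioo_eq_restrict_Ioc]
    intro h
    rw [gradMixedNorm, h, ENNReal.top_rpow_of_pos (by positivity)] at hfin
    exact lt_irrefl _ hfin
  constructor
  · rw [IntegrableOn, ← restrict_Ioo_eq_restrict_Icc]
    exact integrable_toReal_of_lintegral_ne_top hmeas hne
  · rw [← ae_restrict_iff' measurableSet_Ioo]
    filter_upwards [ae_lt_top' hmeas hne] with t ht using ht.ne

lemma ofReal_sq_le_lintegral_sq_deriv {f f' : ℝ → ℝ} {t T : ℝ} (ht : t ∈ Ioo 0 T)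
    (hf : ContinuousOn f (Icc 0 t)) (h0 : f 0 = 0)
    (hd : ∀ s ∈ Ioo 0 t, HasDerivAt f (f' s) s) (hf' : ContinuousOn f' (Ioo 0 T)) :
    ENNReal.ofReal (f t ^ 2) ≤
      ENNReal.ofReal T * ∫⁻ s in Ioo 0 T, ENNReal.ofReal (f' s ^ 2) := by
  obtain ⟨ht0, htT⟩ := ht
  have hT : 0 < T := ht0.trans htT
  by_cases htop : ∫⁻ s in Ioo 0 T, ENNReal.ofReal (f' s ^ 2) = ⊤
  · rw [htop, ENNReal.mul_top (by simpa using hT)]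
    exact le_top
  have hmeas : AEStronglyMeasurable f' (volume.restrict (Ioo 0 T)) :=
    hf'.aestronglyMeasurable measurableSet_Ioo
  have hsq : IntegrableOn (fun s => f' s ^ 2) (Ioo 0 T) := by
    refine ⟨hmeas.pow 2, ?_⟩
    rw [hasFiniteIntegral_iff_ofReal (Eventually.of_forall fun s => sq_nonneg _)]
    exact lt_top_iff_ne_top.2 htop
  have hint : IntegrableOn f' (Ioo 0 T) :=
    ((memLp_two_iff_integrable_sq hmeas).2 hsq).integrable one_le_two
  have hsub : Ioo 0 t ⊆ Ioo 0 T := Ioo_subset_Ioo_right htT.le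
  have hint' : IntervalIntegrable f' volume 0 t :=
    (intervalIntegrable_iff_integrableOn_Ioo_of_le ht0.le).2 (hint.mono_set hsub)
  have hsq' : IntervalIntegrable (fun s => f' s ^ 2) volume 0 t :=
    (intervalIntegrable_iff_integrableOn_Ioo_of_le ht0.le).2 (hsq.mono_set hsub)
  have hftc := intervalIntegral.integral_eq_sub_of_hasDerivAt_of_le ht0.le hf hd hint'
  rw [h0, sub_zero] at hftc
  have hcs : ∫ s in (0 : ℝ)..t, (2 * (f t / t) * f' s - (f t / t) ^ 2) ≤
      ∫ s in (0 : ℝ)..t, f' s ^ 2 :=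
    intervalIntegral.integral_mono_on ht0.le
      ((hint'.const_mul _).sub intervalIntegrable_const) hsq'
      fun s _ => by nlinarith [sq_nonneg (f' s - f t / t)]
  rw [intervalIntegral.integral_sub (hint'.const_mul _) intervalIntegrable_const,
    intervalIntegral.integral_const_mul, hftc, intervalIntegral.integral_const] at hcs
  have hle : f t ^ 2 ≤ t * ∫ s in (0 : ℝ)..t, f' s ^ 2 := by
    have h1 : 2 * (f t / t) * f t - (t - 0) • (f t / t) ^ 2 = f t ^ 2 / t := by
      simp only [smul_eq_mul]
      field_simp
      ring
    rw [h1, div_le_iff₀ ht0] at hcs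
    linarith
  have hle' : ∫ s in (0 : ℝ)..t, f' s ^ 2 ≤ ∫ s in Ioo 0 T, f' s ^ 2 := by
    rw [intervalIntegral.integral_of_le ht0.le, integral_Ioc_eq_integral_Ioo]
    exact setIntegral_mono_set hsq (Eventually.of_forall fun s => sq_nonneg _)
      hsub.eventuallyLE
  have hnn : 0 ≤ ∫ s in Ioo 0 T, f' s ^ 2 := integral_nonneg fun s => sq_nonneg _
  rw [← ofReal_integral_eq_lintegral_ofReal hsq (Eventually.of_forall fun s => sq_nonneg _),
    ← ENNReal.ofReal_mul hT.le]
  refine ENNReal.ofReal_le_ofReal (hle.trans ?_)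
  exact (mul_le_mul_of_nonneg_left hle' ht0.le).trans (mul_le_mul_of_nonneg_right htT.le hnn)

/-- Two maps with the same initial value and finite energy stay at uniformly bounded `L²`
distance. -/
lemma exists_lintegral_sq_difference_le {u₁ u₂ : Sp n × ℝ → Fin k → ℝ} {T : ℝ}
    (hc₁ : ContinuousOn u₁ {z | z.2 ∈ Icc 0 T}) (hc₂ : ContinuousOn u₂ {z | z.2 ∈ Icc 0 T})
    (hu₁ : ∀ i, ContDiffOn ℝ (⊤ : ℕ∞) (fun z => u₁ z i) {z | z.2 ∈ Ioo 0 T})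
    (hu₂ : ∀ i, ContDiffOn ℝ (⊤ : ℕ∞) (fun z => u₂ z i) {z | z.2 ∈ Ioo 0 T})
    (he₁ : IntegrableOn (fun z => gradSq u₁ z + dtSq u₁ z) {z : Sp n × ℝ | z.2 ∈ Ioc 0 T})
    (he₂ : IntegrableOn (fun z => gradSq u₂ z + dtSq u₂ z) {z : Sp n × ℝ | z.2 ∈ Ioc 0 T})
    (h0 : ∀ x, u₁ (x, 0) = u₂ (x, 0)) :
    ∃ M : ℝ≥0, ∀ t ∈ Ioo 0 T,
      ∫⁻ x : Sp n, ENNReal.ofReal (∑ i, (u₁ (x, t) i - u₂ (x, t) i) ^ 2) ≤ M := by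
  set e : Sp n × ℝ → ℝ := fun z =>
    2 * ((gradSq u₁ z + dtSq u₁ z) + (gradSq u₂ z + dtSq u₂ z)) with he
  have hint : IntegrableOn e {z : Sp n × ℝ | z.2 ∈ Ioc 0 T} := (he₁.add he₂).const_mul 2
  have hset : {z : Sp n × ℝ | z.2 ∈ Ioc 0 T} = (univ : Set (Sp n)) ×ˢ Ioc 0 T := by
    ext z; simp
  rw [hset] at hint
  have hfin : ENNReal.ofReal T * ∫⁻ x : Sp n, ∫⁻ s in Ioo 0 T, ENNReal.ofReal (e (x, s)) ≠ ⊤ := by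
    refine ENNReal.mul_ne_top ENNReal.ofReal_ne_top ?_
    have h1 := setLIntegral_prod (μ := (volume : Measure (Sp n))) (ν := (volume : Measure ℝ))
      (s := univ) (t := Ioc 0 T) (fun z => ENNReal.ofReal (e z))
      hint.aestronglyMeasurable.aemeasurable.ennreal_ofReal
    rw [Measure.restrict_univ] at h1
    simp only [restrict_Ioo_eq_restrict_Ioc]
    rw [← h1]
    exact hint.lintegral_lt_top.ne
  refine ⟨(ENNReal.ofReal T *
    ∫⁻ x : Sp n, ∫⁻ s in Ioo 0 T, ENNReal.ofReal (e (x, s))).toNNReal, fun t ht => ?_⟩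
  rw [ENNReal.coe_toNNReal hfin, ← lintegral_const_mul' _ _ ENNReal.ofReal_ne_top]
  refine lintegral_mono fun x => ?_
  have hcurve : Continuous fun s : ℝ => (x, s) := by fun_prop
  have hv : ∀ i, ContinuousOn (fun s => pd u₁ i (tdir n) (x, s) - pd u₂ i (tdir n) (x, s))
      (Ioo 0 T) := fun i =>
    ((continuousOn_pd hu₁ i _).comp hcurve.continuousOn fun s hs => hs).sub
      ((continuousOn_pd hu₂ i _).comp hcurve.continuousOn fun s hs => hs)
  have hi : ∀ i, ENNReal.ofReal ((u₁ (x, t) i - u₂ (x, t) i) ^ 2) ≤ ENNReal.ofReal T *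
      ∫⁻ s in Ioo 0 T,
        ENNReal.ofReal ((pd u₁ i (tdir n) (x, s) - pd u₂ i (tdir n) (x, s)) ^ 2) := fun i => by
    have hmaps : MapsTo (fun s : ℝ => (x, s)) (Icc 0 t) {z : Sp n × ℝ | z.2 ∈ Icc 0 T} :=
      fun s hs => ⟨hs.1, hs.2.trans ht.2.le⟩
    refine ofReal_sq_le_lintegral_sq_deriv (f := fun s => u₁ (x, s) i - u₂ (x, s) i) ht
      (((continuousOn_pi.1 hc₁ i).comp hcurve.continuousOn hmaps).sub
        ((continuousOn_pi.1 hc₂ i).comp hcurve.continuousOn hmaps)) (by simp [h0])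
      (fun s hs => ?_) (hv i)
    have hs' : ((x, s) : Sp n × ℝ).2 ∈ Ioo 0 T := ⟨hs.1, hs.2.trans ht.2⟩
    exact (hasDerivAt_time (differentiableAt_of_openSlab (hu₁ i) hs')).sub
      (hasDerivAt_time (differentiableAt_of_openSlab (hu₂ i) hs'))
  rw [ENNReal.ofReal_sum_of_nonneg fun i _ => sq_nonneg _]
  refine (Finset.sum_le_sum fun i _ => hi i).trans ?_
  rw [← Finset.mul_sum, ← lintegral_finsetSum' _ fun i _ =>
    (((hv i).aemeasurable measurableSet_Ioo).pow_const 2).ennreal_ofReal]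
  gcongr with s
  rw [← ENNReal.ofReal_sum_of_nonneg fun i _ => sq_nonneg _]
  refine ENNReal.ofReal_le_ofReal ?_
  have hdt : ∑ i, (pd u₁ i (tdir n) (x, s) - pd u₂ i (tdir n) (x, s)) ^ 2 ≤
      2 * (dtSq u₁ (x, s) + dtSq u₂ (x, s)) := by
    rw [dtSq, dtSq, ← Finset.sum_add_distrib, Finset.mul_sum]
    exact Finset.sum_le_sum fun i _ => by
      nlinarith [sq_nonneg (pd u₁ i (tdir n) (x, s) + pd u₂ i (tdir n) (x, s))]
  simp only [he]
  linarith [gradSq_nonneg u₁ (x, s), gradSq_nonneg u₂ (x, s)]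

end EnergyBounds

section Uniqueness

variable {n k : ℕ}

/-- Cut-off functions equal to one on large balls, with small gradient. -/
lemma exists_cutoff (n : ℕ) : ∃ c : ℝ, 0 ≤ c ∧ ∀ ρ : ℝ, 0 < ρ → ∃ η : Sp n → ℝ,
    ContDiff ℝ 2 η ∧ HasCompactSupport η ∧ (∀ x ∈ ball (0 : Sp n) ρ, η x = 1) ∧
      ∀ x, spatialGradSq η x ≤ c / ρ ^ 2 := by
  let χ : ContDiffBump (0 : Sp n) := ⟨1, 2, one_pos, one_lt_two⟩
  have hχ : ContDiff ℝ 2 χ := χ.contDiff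
  obtain ⟨c, hc⟩ := (χ.hasCompactSupport.spatialGradSq).exists_bound_of_continuous
    (hχ.of_le one_le_two).continuous_spatialGradSq
  refine ⟨c, (norm_nonneg _).trans (hc 0), fun ρ hρ => ⟨fun x => χ (ρ⁻¹ • x),
    hχ.comp (contDiff_const_smul _), ?_, fun x hx => ?_, fun x => ?_⟩⟩
  · exact χ.hasCompactSupport.comp_smul (inv_ne_zero hρ.ne')
  · refine χ.one_of_mem_closedBall ?_
    rw [mem_closedBall_zero_iff, norm_smul, norm_inv, Real.norm_of_nonneg hρ.le,
      inv_mul_le_iff₀ hρ, mul_one]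
    exact (mem_ball_zero_iff.1 hx).le
  · have h1 : spatialGradSq (fun x => χ (ρ⁻¹ • x)) x = spatialGradSq χ (ρ⁻¹ • x) / ρ ^ 2 := by
      simp only [spatialGradSq, Finset.sum_div]
      refine Finset.sum_congr rfl fun α _ => ?_
      rw [fderiv_comp_smul, _root_.smul_apply, smul_eq_mul]
      field_simp
    rw [h1]
    gcongr
    exact (le_abs_self _).trans (hc _)

lemma eq_of_intervalIntegral_le_half {u₁ u₂ : Sp n × ℝ → Fin k → ℝ} {T l q C : ℝ} {M : ℝ≥0}
    (hC0 : 0 ≤ C)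
    (hC : ∀ g : Sp n → ℝ, ContDiff ℝ 1 g → HasCompactSupport g →
      ∀ f : Sp n → ℝ, Continuous f → (∀ x, 0 ≤ f x) →
        (∫⁻ x, ENNReal.ofReal (f x ^ (l / 2))) ^ (q / l) ≠ ⊤ →
        ∫ x, f x * g x ^ 2 ≤ (∫ x, spatialGradSq g x) +
          C * ((∫⁻ x, ENNReal.ofReal (f x ^ (l / 2))) ^ (q / l)).toReal * ∫ x, g x ^ 2)
    (hc₁ : ContinuousOn u₁ {z | z.2 ∈ Icc 0 T}) (hc₂ : ContinuousOn u₂ {z | z.2 ∈ Icc 0 T})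
    (hsph₁ : SphereValued u₁ {z | z.2 ∈ Icc 0 T}) (hsph₂ : SphereValued u₂ {z | z.2 ∈ Icc 0 T})
    (hu₁ : ∀ i, ContDiffOn ℝ (⊤ : ℕ∞) (fun z => u₁ z i) {z | z.2 ∈ Ioo 0 T})
    (hu₂ : ∀ i, ContDiffOn ℝ (⊤ : ℕ∞) (fun z => u₂ z i) {z | z.2 ∈ Ioo 0 T})
    (hflow₁ : HeatFlow u₁ {z | z.2 ∈ Ioc 0 T}) (hflow₂ : HeatFlow u₂ {z | z.2 ∈ Ioc 0 T})
    (hM : ∀ t ∈ Ioo 0 T,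
      ∫⁻ x : Sp n, ENNReal.ofReal (∑ i, (u₁ (x, t) i - u₂ (x, t) i) ^ 2) ≤ M)
    {F : ℝ → ℝ} (hF : F = fun t => C *
      (((∫⁻ x : Sp n, ENNReal.ofReal (gradSq u₁ (x, t) ^ (l / 2))) ^ (q / l)).toReal +
        ((∫⁻ x : Sp n, ENNReal.ofReal (gradSq u₂ (x, t) ^ (l / 2))) ^ (q / l)).toReal))
    (hFint : IntegrableOn F (Icc 0 T))
    (hfin₁ : ∀ᵐ t, t ∈ Ioo 0 T →
      (∫⁻ x : Sp n, ENNReal.ofReal (gradSq u₁ (x, t) ^ (l / 2))) ^ (q / l) ≠ ⊤)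
    (hfin₂ : ∀ᵐ t, t ∈ Ioo 0 T →
      (∫⁻ x : Sp n, ENNReal.ofReal (gradSq u₂ (x, t) ^ (l / 2))) ^ (q / l) ≠ ⊤)
    {s τ : ℝ} (hs : 0 ≤ s) (hτ : τ ≤ T) (heq : ∀ x, u₁ (x, s) = u₂ (x, s))
    (hsmall : ∫ t in s..τ, F t ≤ 1 / 2) {t : ℝ} (ht : t ∈ Ioo s τ) (x : Sp n) :
    u₁ (x, t) = u₂ (x, t) := by
  have hIcc : Icc s τ ⊆ Icc 0 T := Icc_subset_Icc hs hτ
  have hIoo : Ioo s τ ⊆ Ioo 0 T := Ioo_subset_Ioo hs hτ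
  set φ : Sp n × ℝ → ℝ := fun z => ∑ i, (u₁ z i - u₂ z i) ^ 2 with hφ
  set ψ : Sp n × ℝ → ℝ := fun z =>
    ∑ i, 2 * (u₁ z i - u₂ z i) * (pd u₁ i (tdir n) z - pd u₂ i (tdir n) z) with hψ
  have hφ0 : ∀ z, 0 ≤ φ z := fun z => Finset.sum_nonneg fun i _ => sq_nonneg _
  have hw : ∀ i, ContinuousOn (fun z => u₁ z i - u₂ z i) {z | z.2 ∈ Icc 0 T} := fun i =>
    (continuousOn_pi.1 hc₁ i).sub (continuousOn_pi.1 hc₂ i)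
  have hφc : ContinuousOn φ {z | z.2 ∈ Icc 0 T} :=
    continuousOn_finsetSum _ fun i _ => (hw i).pow 2
  have hslab : {z : Sp n × ℝ | z.2 ∈ Ioo 0 T} ⊆ {z | z.2 ∈ Icc 0 T} :=
    fun z hz => Ioo_subset_Icc_self hz
  have hψc : ContinuousOn ψ {z | z.2 ∈ Ioo 0 T} :=
    continuousOn_finsetSum _ fun i _ => (continuousOn_const.mul ((hw i).mono hslab)).mul
      ((continuousOn_pd hu₁ i _).sub (continuousOn_pd hu₂ i _))
  have hd : ∀ z : Sp n × ℝ, z.2 ∈ Ioo 0 T → HasDerivAt (fun r => φ (z.1, r)) (ψ z) z.2 := by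
    intro z hz
    refine HasDerivAt.fun_sum fun i _ => ?_
    have h1 := ((hasDerivAt_time (differentiableAt_of_openSlab (hu₁ i) hz)).sub
      (hasDerivAt_time (differentiableAt_of_openSlab (hu₂ i) hz))).pow 2
    exact h1.congr_deriv (by simp [pd])
  have hφint : ∀ r ∈ Ioo 0 T, Integrable (fun x => φ (x, r)) := fun r hr =>
    ⟨(continuous_slice hφc (Ioo_subset_Icc_self hr)).aestronglyMeasurable, by
      rw [hasFiniteIntegral_iff_ofReal (Eventually.of_forall fun x => hφ0 _)]
      exact (hM r hr).trans_lt ENNReal.coe_lt_top⟩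
  have hφM : ∀ r ∈ Ioo 0 T, ∫ x, φ (x, r) ≤ M := fun r hr => by
    rw [integral_eq_lintegral_of_nonneg_ae (Eventually.of_forall fun x => hφ0 _)
      (hφint r hr).aestronglyMeasurable]
    exact ENNReal.toReal_le_coe_of_le_coe (hM r hr)
  have hF0 : ∀ r, 0 ≤ F r := fun r => by rw [hF]; positivity
  obtain ⟨c, hc0, hcut⟩ := exists_cutoff n
  have hball : ∀ R ρ : ℝ, 0 < R → R ≤ ρ →
      ∫ y in ball (0 : Sp n) R, φ (y, t) ≤ 2 * (2 * c * M) * (τ - s) / ρ ^ 2 := by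
    intro R ρ hR hRρ
    obtain ⟨η, hη, hηs, hη1, hηc⟩ := hcut ρ (hR.trans_le hRρ)
    have hη2 : Continuous fun y => η y ^ 2 := hη.continuous.pow 2
    have hGint : ∀ r ∈ Icc s τ, Integrable fun y => η y ^ 2 * φ (y, r) := fun r hr =>
      Continuous.integrable_of_hasCompactSupport
        (hη2.mul (continuous_slice hφc (hIcc hr)))
        (hηs.fun_sq.mul_right (f' := fun y => φ (y, r)))
    have hGc : ContinuousOn (fun r => ∫ y, η y ^ 2 * φ (y, r)) (Icc s τ) := by
      refine continuousOn_integral_of_compact_support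
        (f := fun r y => η y ^ 2 * φ (y, r)) hηs ?_ fun r y _ hy => ?_
      · refine (hη2.comp continuous_snd).continuousOn.mul (hφc.comp
          continuous_swap.continuousOn fun z hz => hIcc hz.1)
      · simp [image_eq_zero_of_notMem_tsupport hy]
    have hG := le_of_deriv_le_add_mul (G := fun r => ∫ y, η y ^ 2 * φ (y, r))
      (G' := fun r => ∫ y, η y ^ 2 * ψ (y, r)) (F := F) (ε := 2 * (c / ρ ^ 2) * M)
      (a := s) (b := τ) (by positivity) hGc (by simp [hφ, heq])
      (fun r _ => integral_nonneg fun y => mul_nonneg (sq_nonneg _) (hφ0 _))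
      (fun r hr => hasDerivAt_integral_cutoff hη.continuous hηs (hφc.mono hslab) hψc hd (hIoo hr))
      (hFint.mono_set hIcc) hF0 ?_ hsmall t (Ioo_subset_Icc_self ht)
    · calc ∫ y in ball (0 : Sp n) R, φ (y, t)
          = ∫ y in ball (0 : Sp n) R, η y ^ 2 * φ (y, t) :=
            setIntegral_congr_fun measurableSet_ball fun y hy => by
              simp [hη1 y (ball_subset_ball hRρ hy)]
        _ ≤ ∫ y, η y ^ 2 * φ (y, t) :=
            setIntegral_le_integral (hGint t (Ioo_subset_Icc_self ht))
              (Eventually.of_forall fun y => mul_nonneg (sq_nonneg _) (hφ0 _))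
        _ ≤ _ := hG
        _ = _ := by ring
    · filter_upwards [hfin₁, hfin₂] with r hr₁ hr₂ hr
      have hr0 : r ∈ Ioo 0 T := hIoo hr
      have hmain := integral_cutoff_mul_difference_le hC
        (a := fun i y => u₁ (y, r) i) (b := fun i y => u₂ (y, r) i)
        (τ := fun i y => pd u₁ i (tdir n) (y, r) - pd u₂ i (tdir n) (y, r))
        (f₁ := fun y => gradSq u₁ (y, r)) (f₂ := fun y => gradSq u₂ (y, r))
        (fun i => contDiff_slice (hu₁ i) hr0) (fun i => contDiff_slice (hu₂ i) hr0)
        (fun y => hsph₁ (y, r) (Ioo_subset_Icc_self hr0))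
        (fun y => hsph₂ (y, r) (Ioo_subset_Icc_self hr0))
        (continuous_slice (continuousOn_gradSq hu₁) hr0)
        (continuous_slice (continuousOn_gradSq hu₂) hr0)
        (fun y => gradSq_nonneg u₁ _) (fun y => gradSq_nonneg u₂ _) (hr₁ hr0) (hr₂ hr0)
        (fun i y => ?_) hη hηs
      · refine hmain.trans ?_
        rw [hF]
        refine add_le_add_left ?_ _
        calc ∫ y, 2 * spatialGradSq η y * φ (y, r)
            ≤ ∫ y, 2 * (c / ρ ^ 2) * φ (y, r) := by
              refine integral_mono_of_nonneg (Eventually.of_forall fun y => ?_)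
                ((hφint r hr0).const_mul _) (Eventually.of_forall fun y => ?_)
              · exact mul_nonneg (mul_nonneg zero_le_two
                  (Finset.sum_nonneg fun α _ => sq_nonneg _)) (hφ0 _)
              · exact mul_le_mul_of_nonneg_right
                  (mul_le_mul_of_nonneg_left (hηc y) zero_le_two) (hφ0 _)
          _ = 2 * (c / ρ ^ 2) * ∫ y, φ (y, r) := integral_const_mul _ _
          _ ≤ _ := mul_le_mul_of_nonneg_left (hφM r hr0) (by positivity)
      · have hz : ((y, r) : Sp n × ℝ) ∈ {z : Sp n × ℝ | z.2 ∈ Ioc 0 T} := Ioo_subset_Ioc_self hr0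
        simp only [hflow₁ _ hz i, hflow₂ _ hz i, fderiv_fderiv_slice_apply (hu₁ i) hr0,
          fderiv_fderiv_slice_apply (hu₂ i) hr0]
        rfl
  have ht0 : t ∈ Ioo 0 T := hIoo ht
  have hR : 0 < ‖x‖ + 1 := by positivity
  have hzero : ∫ y in ball (0 : Sp n) (‖x‖ + 1), φ (y, t) ≤ 0 := by
    have hlim : Tendsto (fun ρ : ℝ => 2 * (2 * c * M) * (τ - s) / ρ ^ 2) atTop (𝓝 0) :=
      tendsto_const_nhds.div_atTop (tendsto_pow_atTop two_ne_zero)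
    refine ge_of_tendsto hlim ?_
    filter_upwards [eventually_ge_atTop (‖x‖ + 1)] with ρ hρ using hball _ ρ hR hρ
  have hae := (setIntegral_eq_zero_iff_of_nonneg_ae (Eventually.of_forall fun y => hφ0 (y, t))
    (hφint t ht0).integrableOn).1 (le_antisymm hzero (integral_nonneg fun y => hφ0 _))
  have hφx : φ (x, t) = 0 := Measure.eqOn_open_of_ae_eq hae isOpen_ball
    (continuous_slice hφc (Ioo_subset_Icc_self ht0)).continuousOn continuousOn_const
    (mem_ball_zero_iff.2 (lt_add_one _))
  funext i
  have := (Finset.sum_eq_zero_iff_of_nonneg fun i _ => sq_nonneg _).1 hφx i (Finset.mem_univ i)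
  exact sub_eq_zero.1 (pow_eq_zero_iff two_ne_zero |>.1 this)

end Uniqueness

/-- Theorem 1.3 of the paper (case M = ℝⁿ, N = S^{k-1}): uniqueness of Serrin's
`(l,q)`-solutions of the harmonic map heat flow. -/
theorem uniqueness_serrin_solutions_heat_flow_sphere
    (n k : ℕ) (hn : 2 ≤ n) (hk : 2 ≤ k)
    (T : ℝ) (hT : 0 < T)
    (l q : ℝ) (hl : (n : ℝ) < l) (hq : 2 < q) (hlq : (n : ℝ) / l + 2 / q = 1)
    (u₁ u₂ : Sp n × ℝ → Fin k → ℝ)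
    (hcont₁ : ContinuousOn u₁ {z : Sp n × ℝ | z.2 ∈ Icc 0 T})
    (hcont₂ : ContinuousOn u₂ {z : Sp n × ℝ | z.2 ∈ Icc 0 T})
    (hsph₁ : SphereValued u₁ {z : Sp n × ℝ | z.2 ∈ Icc 0 T})
    (hsph₂ : SphereValued u₂ {z : Sp n × ℝ | z.2 ∈ Icc 0 T})
    (hreg₁ : ContDiffOn ℝ (⊤ : ℕ∞) u₁ {z : Sp n × ℝ | z.2 ∈ Ioc 0 T})
    (hreg₂ : ContDiffOn ℝ (⊤ : ℕ∞) u₂ {z : Sp n × ℝ | z.2 ∈ Ioc 0 T})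
    (hflow₁ : HeatFlow u₁ {z : Sp n × ℝ | z.2 ∈ Ioc 0 T})
    (hflow₂ : HeatFlow u₂ {z : Sp n × ℝ | z.2 ∈ Ioc 0 T})
    (henergy₁ : IntegrableOn (fun z => gradSq u₁ z + dtSq u₁ z) {z : Sp n × ℝ | z.2 ∈ Ioc 0 T})
    (henergy₂ : IntegrableOn (fun z => gradSq u₂ z + dtSq u₂ z) {z : Sp n × ℝ | z.2 ∈ Ioc 0 T})
    (hserrin₁ : gradMixedNorm u₁ 0 T l q < ⊤)
    (hserrin₂ : gradMixedNorm u₂ 0 T l q < ⊤)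
    (hinit : ∀ x : Sp n, u₁ (x, 0) = u₂ (x, 0)) :
    ∀ z ∈ {z : Sp n × ℝ | z.2 ∈ Icc 0 T}, u₁ z = u₂ z := by
  have hslab : {z : Sp n × ℝ | z.2 ∈ Ioo 0 T} ⊆ {z | z.2 ∈ Ioc 0 T} :=
    fun z hz => Ioo_subset_Ioc_self hz
  have hu₁ : ∀ i, ContDiffOn ℝ (⊤ : ℕ∞) (fun z => u₁ z i) {z | z.2 ∈ Ioo 0 T} :=
    contDiffOn_pi.1 (hreg₁.mono hslab)
  have hu₂ : ∀ i, ContDiffOn ℝ (⊤ : ℕ∞) (fun z => u₂ z i) {z | z.2 ∈ Ioo 0 T} :=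
    contDiffOn_pi.1 (hreg₂.mono hslab)
  obtain ⟨C, hC⟩ := exists_integral_weight_mul_sq_le hn hl hq hlq
  obtain ⟨M, hM⟩ :=
    exists_lintegral_sq_difference_le hcont₁ hcont₂ hu₁ hu₂ henergy₁ henergy₂ hinit
  obtain ⟨hint₁, hfin₁⟩ := integrableOn_toReal_gradMixedNorm hu₁ (by linarith) hserrin₁
  obtain ⟨hint₂, hfin₂⟩ := integrableOn_toReal_gradMixedNorm hu₂ (by linarith) hserrin₂
  obtain ⟨F, hF⟩ : ∃ F : ℝ → ℝ, F = fun t => C *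
      (((∫⁻ x : Sp n, ENNReal.ofReal (gradSq u₁ (x, t) ^ (l / 2))) ^ (q / l)).toReal +
        ((∫⁻ x : Sp n, ENNReal.ofReal (gradSq u₂ (x, t) ^ (l / 2))) ^ (q / l)).toReal) := ⟨_, rfl⟩
  have hFint : IntegrableOn F (Icc 0 T) := by
    rw [hF]
    exact (hint₁.add hint₂).const_mul _
  have hclosed : IsClosed ({t | ∀ x, u₁ (x, t) = u₂ (x, t)} ∩ Icc 0 T) := by
    have hset : {t | ∀ x, u₁ (x, t) = u₂ (x, t)} ∩ Icc 0 T =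
        ⋂ x, Icc 0 T ∩ (fun t => u₁ (x, t) - u₂ (x, t)) ⁻¹' {0} := by
      ext t
      simp [sub_eq_zero, forall_and, and_comm]
    rw [hset]
    refine isClosed_iInter fun x => ContinuousOn.preimage_isClosed_of_isClosed ?_ isClosed_Icc
      isClosed_singleton
    have hcurve : ContinuousOn (fun t : ℝ => (x, t)) (Icc 0 T) := by fun_prop
    exact (hcont₁.comp hcurve fun t ht => ht).sub (hcont₂.comp hcurve fun t ht => ht)
  have hall : Icc 0 T ⊆ {t | ∀ x, u₁ (x, t) = u₂ (x, t)} := by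
    refine hclosed.Icc_subset_of_forall_mem_nhdsWithin hinit fun s hs => ?_
    obtain ⟨hs, hs0, hsT⟩ := hs
    have hcont := intervalIntegral.continuousOn_primitive_interval (a := s) (b := T) (f := F)
      (by rw [uIcc_of_le hsT.le]; exact hFint.mono_set (Icc_subset_Icc_left hs0))
    rw [uIcc_of_le hsT.le] at hcont
    have hlim : Tendsto (fun τ => ∫ t in s..τ, F t) (𝓝[>] s) (𝓝 0) := by
      have := (hcont s (left_mem_Icc.2 hsT.le)).mono_of_mem_nhdsWithin
        (Icc_mem_nhdsGT_of_mem ⟨le_rfl, hsT⟩)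
      simpa [ContinuousWithinAt] using this
    obtain ⟨τ, hτ, hsτ⟩ := ((hlim.eventually_le_const (by norm_num : (0 : ℝ) < 1 / 2)).and
      (Ioc_mem_nhdsGT hsT)).exists
    filter_upwards [Ioo_mem_nhdsGT hsτ.1] with t ht x
    exact eq_of_intervalIntegral_le_half C.coe_nonneg hC hcont₁ hcont₂ hsph₁ hsph₂ hu₁ hu₂
      hflow₁ hflow₂ hM hF hFint hfin₁ hfin₂ hs0 hsτ.2 hs hτ ht x
  exact fun z hz => hall hz z.1
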